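/- arXiv:2405.13454 — 2 statements merged into one kernel-verified Lean document; each statement's English description precedes it below -/
import Mathlib

section
/- Let p_n be a sequence with p_n ~ λ/n for some λ > 0, and let S_{n,p_n} be the block-size of a fixed element in the random cluster graph CG_{n,p_n} on n vertices. Then P(S_{n,p_n} = 1) → (√(4λ+1) − 1)/(2λ) and P(S_{n,p_n} = 2) → 1 − (√(4λ+1) − 1)/(2λ) as n → ∞. In particular, for λ = 1 the limit of P(S_{n,p_n} = 1) is 1/ρ where ρ = (1+√5)/2. -/
open Finset

/-- Number of intra-block pairs of a set partition. -/
def partWeight {n : ℕ} (P : Finpartition (Finset.univ : Finset (Fin n))) : ℕ :=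
  ∑ S ∈ P.parts, (S.card).choose 2

/-- The generalized Bell number `B_n(w) = ∑_P ∏_{S block of P} w^{C(|S|,2)}`. -/
noncomputable def genBell (n : ℕ) (w : ℝ) : ℝ :=
  ∑ P : Finpartition (Finset.univ : Finset (Fin n)), ∏ S ∈ P.parts, w ^ (S.card).choose 2

/-- The Bell number: number of set partitions of an `n`-element set. -/
noncomputable def Bell (n : ℕ) : ℕ := Nat.card (Finpartition (Finset.univ : Finset (Fin n)))

/-- `P(S_{n,p} = s)`: the probability that the clique of a uniformly random vertex of the
random cluster graph `CG_{n,p}` has size `s`, where `w = p/(1-p)`. -/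
noncomputable def probBlockSize (n s : ℕ) (w : ℝ) : ℝ :=
  ((n - 1).choose (s - 1) : ℝ) * w ^ s.choose 2 * genBell (n - s) w / genBell n w

open Filter

/-- Weighted sum over the partitions of a finset. -/
noncomputable def wsum {α : Type} [DecidableEq α] (S : Finset α) (w : ℝ) : ℝ :=
  ∑ P : Finpartition S, ∏ T ∈ P.parts, w ^ (T.card).choose 2

/-- Fibre of the partitions over the block of `a`. -/
lemma wsum_fiber {α : Type} [DecidableEq α] (S : Finset α) (w : ℝ) (a : α) (ha : a ∈ S)
    (T : Finset α) (hT : T ⊆ S.erase a) :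
    ∑ P : Finpartition S with (P.part a).erase a = T, ∏ U ∈ P.parts, w ^ (U.card).choose 2
      = w ^ (T.card + 1).choose 2 * wsum (S \ insert a T) w := by
  have haT : a ∉ T := fun h => by simpa using hT h
  have hsub : insert a T ⊆ S := by
    intro x hx
    rcases Finset.mem_insert.1 hx with rfl | hx
    · exact ha
    · exact Finset.mem_of_mem_erase (hT hx)
  have hb : insert a T ≠ (⊥ : Finset α) := by
    simp
  have hd : Disjoint (S \ insert a T) (insert a T) := Finset.sdiff_disjoint
  have hu : (S \ insert a T) ⊔ (insert a T) = S := Finset.sdiff_union_of_subset hsub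
  have hnot : ∀ Q : Finpartition (S \ insert a T), insert a T ∉ Q.parts := by
    intro Q hQ
    have := Q.le hQ (Finset.mem_insert_self a T)
    simp at this
  unfold wsum
  rw [Finset.mul_sum]
  symm
  refine Finset.sum_bij (fun Q _ => Q.extend hb hd hu) ?_ ?_ ?_ ?_
  · intro Q _
    simp only [Finset.mem_filter, Finset.mem_univ, true_and]
    have h1 : (Q.extend hb hd hu).part a = insert a T := by
      apply Finpartition.part_eq_of_mem
      · simp [Finpartition.extend]
      · simp
    rw [h1, Finset.erase_insert haT]
  · intro Q _ R _ h
    have h1 : insert (insert a T) Q.parts = insert (insert a T) R.parts :=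
      congrArg Finpartition.parts h
    ext1
    rw [← Finset.erase_insert (hnot Q), ← Finset.erase_insert (hnot R), h1]
  · intro P hP
    simp only [Finset.mem_filter, Finset.mem_univ, true_and] at hP
    have hpart : P.part a = insert a T := by
      rw [← hP, Finset.insert_erase (P.mem_part ha)]
    have hmem : insert a T ∈ P.parts := hpart ▸ (P.part_mem.2 ha)
    have hsup : (P.parts.erase (insert a T)).sup id = S \ insert a T := by
      ext x
      simp only [Finset.mem_sup, Finset.mem_erase, id, Finset.mem_sdiff]
      constructor
      · rintro ⟨U, ⟨hne, hU⟩, hx⟩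
        refine ⟨P.le hU hx, fun hx' => hne ?_⟩
        exact (P.part_eq_of_mem hU hx).symm.trans (P.part_eq_of_mem hmem hx')
      · rintro ⟨hx, hx'⟩
        refine ⟨P.part x, ⟨fun h => hx' (h ▸ P.mem_part hx), P.part_mem.2 hx⟩, P.mem_part hx⟩
    refine ⟨P.ofSubset (Finset.erase_subset _ _) hsup, Finset.mem_univ _, ?_⟩
    ext1
    simp [Finpartition.extend, Finpartition.ofSubset, Finset.insert_erase hmem]
  · intro Q _
    simp only [Finpartition.extend]
    rw [Finset.prod_insert (hnot Q), Finset.card_insert_of_notMem haT]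

lemma wsum_rec {α : Type} [DecidableEq α] (S : Finset α) (w : ℝ) (a : α) (ha : a ∈ S) :
    wsum S w = ∑ T ∈ (S.erase a).powerset,
      w ^ (T.card + 1).choose 2 * wsum (S \ insert a T) w := by
  rw [wsum, ← Finset.sum_fiberwise_of_maps_to (s := Finset.univ)
    (t := (S.erase a).powerset) (g := fun P : Finpartition S => (P.part a).erase a)]
  · refine Finset.sum_congr rfl fun T hT => ?_
    exact wsum_fiber S w a ha T (Finset.mem_powerset.1 hT)
  · intro P _
    exact Finset.mem_powerset.2 (Finset.erase_subset_erase _ (P.part_subset a))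

lemma wsum_empty {α : Type} [DecidableEq α] (w : ℝ) : wsum (∅ : Finset α) w = 1 := by
  unfold wsum
  have h : ∀ P : Finpartition (∅ : Finset α), P.parts = ∅ := fun P =>
    Finpartition.parts_eq_empty_iff.2 rfl
  have : Unique (Finpartition (∅ : Finset α)) :=
    ⟨⟨Finpartition.empty _⟩, fun P => by ext1; rw [h, h]⟩
  rw [Fintype.sum_unique, h]
  simp

/-- The sequence given by the recursion. -/
noncomputable def bb (w : ℝ) : ℕ → ℝ
  | 0 => 1
  | n + 1 => ∑ k : Fin (n + 1), (n.choose k : ℝ) * w ^ ((k : ℕ) + 1).choose 2 * bb w (n - k)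
decreasing_by omega

lemma bb_succ (w : ℝ) (n : ℕ) : bb w (n + 1) =
    ∑ k ∈ Finset.range (n + 1), (n.choose k : ℝ) * w ^ (k + 1).choose 2 * bb w (n - k) := by
  rw [bb, Finset.sum_range]

lemma wsum_eq_bb {α : Type} [DecidableEq α] (w : ℝ) : ∀ (n : ℕ) (S : Finset α), S.card = n →
    wsum S w = bb w n := by
  intro n
  induction n using Nat.strong_induction_on with
  | _ n ih =>
    intro S hS
    rcases S.eq_empty_or_nonempty with rfl | ⟨a, ha⟩
    · simp at hS
      subst hS
      rw [wsum_empty, bb]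
    · obtain ⟨m, rfl⟩ : ∃ m, n = m + 1 :=
        ⟨n - 1, by have := Finset.card_pos.2 ⟨a, ha⟩; omega⟩
      have hc : (S.erase a).card = m := by rw [Finset.card_erase_of_mem ha, hS]; rfl
      rw [wsum_rec S w a ha, bb_succ]
      have : ∀ T ∈ (S.erase a).powerset, w ^ (T.card + 1).choose 2 * wsum (S \ insert a T) w
          = (fun k => w ^ (k + 1).choose 2 * bb w (m - k)) T.card := by
        intro T hT
        have hT := Finset.mem_powerset.1 hT
        have haT : a ∉ T := fun h => by simpa using hT h
        have hsub : insert a T ⊆ S := by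
          intro x hx
          rcases Finset.mem_insert.1 hx with rfl | hx
          · exact ha
          · exact Finset.mem_of_mem_erase (hT hx)
        have hcard : (S \ insert a T).card = m - T.card := by
          rw [Finset.card_sdiff_of_subset hsub, Finset.card_insert_of_notMem haT, hS]
          omega
        simp only
        rw [ih (m - T.card) (by omega) _ hcard]
      rw [Finset.sum_congr rfl this,
        Finset.sum_powerset_apply_card (fun k => w ^ (k + 1).choose 2 * bb w (m - k)), hc]
      refine Finset.sum_congr rfl fun k _ => ?_
      rw [nsmul_eq_mul, mul_assoc]

lemma genBell_eq_bb (n : ℕ) (w : ℝ) : genBell n w = bb w n :=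
  wsum_eq_bb w n (Finset.univ : Finset (Fin n)) (by simp)

lemma bb_pos (w : ℝ) (hw : 0 < w) : ∀ n, 0 < bb w n := by
  intro n
  induction n using Nat.strong_induction_on with
  | _ n ih =>
    cases n with
    | zero => rw [bb]; exact one_pos
    | succ m =>
      rw [bb_succ]
      refine Finset.sum_pos (fun k hk => ?_) ⟨0, by simp⟩
      have hk := Finset.mem_range.1 hk
      have h1 := ih (m - k) (by omega)
      have h2 : (0 : ℝ) < (m.choose k : ℝ) := by
        exact_mod_cast Nat.choose_pos (by omega)
      positivity

lemma bb_le_succ (w : ℝ) (hw : 0 < w) (n : ℕ) : bb w n ≤ bb w (n + 1) := by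
  rw [bb_succ]
  have := Finset.single_le_sum (s := Finset.range (n + 1))
    (f := fun k => (n.choose k : ℝ) * w ^ (k + 1).choose 2 * bb w (n - k)) (fun k _ => by
      have := bb_pos w hw (n - k)
      positivity) (Finset.mem_range.2 (Nat.succ_pos n))
  simpa using this

lemma bb_mono (w : ℝ) (hw : 0 < w) : Monotone (bb w) := monotone_nat_of_le_succ (bb_le_succ w hw)

lemma bb_two (w : ℝ) (m : ℕ) : bb w (m + 2) = bb w (m + 1) + (m + 1) * w * bb w m +
    ∑ k ∈ Finset.range m,
      ((m + 1).choose (k + 2) : ℝ) * w ^ (k + 3).choose 2 * bb w (m + 1 - (k + 2)) := by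
  rw [bb_succ, Finset.sum_range_succ', Finset.sum_range_succ']
  simp
  ring

lemma err_bound (w K : ℝ) (hw : 0 < w) (hw1 : w ≤ 1) (m : ℕ) (hK : (m + 1) * w ≤ K) :
    0 ≤ bb w (m + 2) - bb w (m + 1) - (m + 1) * w * bb w m ∧
    bb w (m + 2) - bb w (m + 1) - (m + 1) * w * bb w m ≤ w * Real.exp K * bb w (m + 2) := by
  have hE : bb w (m + 2) - bb w (m + 1) - (m + 1) * w * bb w m = ∑ k ∈ Finset.range m,
      ((m + 1).choose (k + 2) : ℝ) * w ^ (k + 3).choose 2 * bb w (m + 1 - (k + 2)) := by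
    rw [bb_two]; ring
  rw [hE]
  constructor
  · refine Finset.sum_nonneg fun k _ => ?_
    have := bb_pos w hw (m + 1 - (k + 2))
    positivity
  · have hx : 0 ≤ (m + 1) * w := by positivity
    calc _ ≤ ∑ k ∈ Finset.range m,
          w * bb w (m + 2) * (((m + 1) * w) ^ (k + 2) / (k + 2).factorial) := by
          refine Finset.sum_le_sum fun k _ => ?_
          have h1 : ((m + 1).choose (k + 2) : ℝ) ≤ ((m : ℝ) + 1) ^ (k + 2) / (k + 2).factorial := by
            have := Nat.choose_le_pow_div (α := ℝ) (k + 2) (m + 1)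
            exact_mod_cast this
          have h2 : w ^ (k + 3).choose 2 ≤ w ^ (k + 3) :=
            pow_le_pow_of_le_one hw.le hw1 (by
              rw [Nat.choose_succ_succ' (k + 2) 1, Nat.choose_one_right]
              have : 0 < (k + 2).choose 2 := Nat.choose_pos (by omega)
              show k + 3 ≤ k + 2 + (k + 2).choose 2
              omega)
          have h3 : bb w (m + 1 - (k + 2)) ≤ bb w (m + 2) := bb_mono w hw (by omega)
          have h4 := bb_pos w hw (m + 1 - (k + 2))
          have h5 := bb_pos w hw (m + 2)
          calc _ ≤ ((m : ℝ) + 1) ^ (k + 2) / (k + 2).factorial * w ^ (k + 3) * bb w (m + 2) := by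
                gcongr
            _ = _ := by rw [mul_pow]; ring
      _ = w * bb w (m + 2) * ∑ k ∈ Finset.range m,
            (((m + 1) * w) ^ (k + 2) / (k + 2).factorial) := by rw [Finset.mul_sum]
      _ ≤ w * bb w (m + 2) * Real.exp K := by
          have h5 := bb_pos w hw (m + 2)
          have h6 := Real.sum_le_exp_of_nonneg hx (m + 2)
          rw [Finset.sum_range_succ', Finset.sum_range_succ'] at h6
          have h7 : Real.exp ((m + 1) * w) ≤ Real.exp K := Real.exp_le_exp.2 hK
          gcongr
          refine le_trans ?_ h7
          refine le_trans ?_ h6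
          rw [add_assoc]
          refine le_add_of_nonneg_right ?_
          positivity
      _ = _ := by ring

/-- Uniqueness of the bounded solution of the limiting recursion. -/
lemma limit_unique (lam x : ℝ) (hlam : 0 < lam) (hx0 : 0 < x) (hx : lam * x ^ 2 + x = 1)
    (r : ℕ → ℝ) (hr : ∀ j, r j ∈ Set.Icc (0 : ℝ) 1)
    (hrec : ∀ j, r j + lam * r j * r (j + 1) = 1) : ∀ j, r j = x := by
  have hx1 : x < 1 := by nlinarith [mul_pos hlam (pow_pos hx0 2)]
  have h1 : ∀ j, |r j - x| = lam * x * r j * |r (j + 1) - x| := by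
    intro j
    have h0 := (hr j).1
    have : r j - x = -(lam * x * r j * (r (j + 1) - x)) := by
      linear_combination r j * (-1) * hx + x * hrec j
    rw [this, abs_neg, abs_mul, abs_of_nonneg (by positivity)]
  have h2 : ∀ j, |r j - x| ≤ (1 - x) * |r (j + 2) - x| := by
    intro j
    have : |r j - x| = (1 - x) * (1 - r j) * |r (j + 2) - x| := by
      rw [h1 j, h1 (j + 1), show 1 - x = lam * x ^ 2 by linarith,
        show 1 - r j = lam * r j * r (j + 1) by linarith [hrec j]]
      ring
    rw [this]
    have h0 := (hr j).1
    have : 0 ≤ 1 - x := by linarith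
    refine mul_le_mul_of_nonneg_right ?_ (abs_nonneg _)
    nlinarith
  have h3 : ∀ k j, |r j - x| ≤ (1 - x) ^ k := by
    intro k
    induction k with
    | zero =>
      intro j
      have := hr j
      rw [pow_zero, abs_le]
      constructor <;> linarith [this.1, this.2]
    | succ k ih =>
      intro j
      rw [pow_succ']
      exact (h2 j).trans (mul_le_mul_of_nonneg_left (ih _) (by linarith))
  intro j
  have h4 : Tendsto (fun k : ℕ => (1 - x) ^ k) atTop (nhds 0) :=
    tendsto_pow_atTop_nhds_zero_of_lt_one (by linarith) (by linarith)
  have h5 : |r j - x| ≤ 0 := ge_of_tendsto' h4 fun k => h3 k j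
  exact sub_eq_zero.1 (abs_nonpos_iff.1 h5)

/-- The ratio of consecutive generalized Bell numbers, `j` steps below `n`. -/
noncomputable def rr (W : ℕ → ℝ) (j n : ℕ) : ℝ := bb (W n) (n - j - 1) / bb (W n) (n - j)

lemma rr_mem (W : ℕ → ℝ) (hW : ∀ n, 0 < W n) (j n : ℕ) : rr W j n ∈ Set.Icc (0 : ℝ) 1 := by
  have h1 := bb_pos (W n) (hW n) (n - j - 1)
  have h2 := bb_pos (W n) (hW n) (n - j)
  exact ⟨by unfold rr; positivity, by
    unfold rr; rw [div_le_one h2]; exact bb_mono _ (hW n) (by omega)⟩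

lemma err_tendsto (lam : ℝ) (W : ℕ → ℝ) (hW : ∀ n, 0 < W n)
    (hW0 : Tendsto W atTop (nhds 0)) (hWn : Tendsto (fun n : ℕ => W n * n) atTop (nhds lam))
    (j : ℕ) : Tendsto (fun n : ℕ => 1 - rr W j n
      - ((n : ℝ) - j - 1) * W n * (rr W j n * rr W (j + 1) n)) atTop (nhds 0) := by
  have hlim : Tendsto (fun n : ℕ => W n * Real.exp (lam + 1)) atTop (nhds 0) := by
    simpa using hW0.mul_const (Real.exp (lam + 1))
  have key : ∀ᶠ n : ℕ in atTop, 0 ≤ 1 - rr W j n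
      - ((n : ℝ) - j - 1) * W n * (rr W j n * rr W (j + 1) n) ∧ 1 - rr W j n
      - ((n : ℝ) - j - 1) * W n * (rr W j n * rr W (j + 1) n) ≤ W n * Real.exp (lam + 1) := by
    filter_upwards [eventually_ge_atTop (j + 2), hW0.eventually (eventually_le_nhds one_pos),
      hWn.eventually (eventually_le_nhds (lt_add_one lam))] with n hn h1 h2
    obtain ⟨m, rfl⟩ : ∃ m, n = m + 2 + j := ⟨n - j - 2, by omega⟩
    have hp := hW (m + 2 + j)
    unfold rr
    rw [show m + 2 + j - j - 1 = m + 1 by omega, show m + 2 + j - j = m + 2 by omega,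
      show m + 2 + j - (j + 1) - 1 = m by omega, show m + 2 + j - (j + 1) = m + 1 by omega]
    generalize W (m + 2 + j) = w at *
    have hb := err_bound w (lam + 1) hp h1 m (by
      refine le_trans ?_ h2
      rw [mul_comm]
      refine mul_le_mul_of_nonneg_left ?_ hp.le
      push_cast
      linarith [(Nat.cast_nonneg j : (0 : ℝ) ≤ j)])
    have p2 := bb_pos w hp (m + 2)
    have p1 := bb_pos w hp (m + 1)
    have heq : 1 - bb w (m + 1) / bb w (m + 2) - (((m + 2 + j : ℕ) : ℝ) - j - 1) * w *
        (bb w (m + 1) / bb w (m + 2) * (bb w m / bb w (m + 1)))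
        = (bb w (m + 2) - bb w (m + 1) - (m + 1) * w * bb w m) / bb w (m + 2) := by
      push_cast
      field_simp
      ring
    rw [heq]
    exact ⟨div_nonneg hb.1 p2.le, (div_le_iff₀ p2).2 hb.2⟩
  exact tendsto_of_tendsto_of_tendsto_of_le_of_le' tendsto_const_nhds hlim
    (key.mono fun n h => h.1) (key.mono fun n h => h.2)

lemma rr_tendsto (lam x : ℝ) (hlam : 0 < lam) (hx0 : 0 < x) (hx : lam * x ^ 2 + x = 1)
    (W : ℕ → ℝ) (hW : ∀ n, 0 < W n)
    (hW0 : Tendsto W atTop (nhds 0)) (hWn : Tendsto (fun n : ℕ => W n * n) atTop (nhds lam)) :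
    Tendsto (rr W 0) atTop (nhds x) := by
  rw [tendsto_iff_ultrafilter]
  intro g hg
  have hlim : ∀ j, ∃ a ∈ Set.Icc (0 : ℝ) 1, Tendsto (rr W j) g (nhds a) := by
    intro j
    exact isCompact_Icc.ultrafilter_le_nhds (g.map (rr W j))
      (le_principal_iff.2 (Filter.mem_map.2 (Filter.univ_mem' fun n => rr_mem W hW j n)))
  choose r hr hrt using hlim
  have hrec : ∀ j, r j + lam * r j * r (j + 1) = 1 := by
    intro j
    have hc : Tendsto (fun n : ℕ => ((n : ℝ) - j - 1) * W n) atTop (nhds lam) := by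
      have := hWn.sub (hW0.const_mul ((j : ℝ) + 1))
      simp only [mul_zero, sub_zero] at this
      refine this.congr fun n => by ring
    have h1 := (err_tendsto lam W hW hW0 hWn j).mono_left hg
    have h2 := ((hrt j).const_sub 1).sub ((hc.mono_left hg).mul ((hrt j).mul (hrt (j + 1))))
    have := tendsto_nhds_unique h1 h2
    linarith
  rw [← limit_unique lam x hlam hx0 hx r hr hrec 0]
  exact hrt 0

lemma sparse_aux (lam : ℝ) (hlam : 0 < lam) (p : ℕ → ℝ)
    (hp01 : ∀ n, p n ∈ Set.Ioo (0 : ℝ) 1)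
    (hp : Tendsto (fun n : ℕ => p n * n / lam) atTop (nhds 1)) (x : ℝ) (hx0 : 0 < x)
    (hx : lam * x ^ 2 + x = 1) :
    Tendsto (fun n : ℕ => probBlockSize n 1 (p n / (1 - p n))) atTop (nhds x) ∧
    Tendsto (fun n : ℕ => probBlockSize n 2 (p n / (1 - p n))) atTop (nhds (1 - x)) := by
  have hpn : Tendsto (fun n : ℕ => p n * n) atTop (nhds lam) := by
    have := hp.mul_const lam
    rw [one_mul] at this
    refine this.congr fun n => by field_simp
  have hp0 : Tendsto p atTop (nhds 0) := by
    have := hpn.mul (tendsto_inv_atTop_nhds_zero_nat (𝕜 := ℝ))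
    rw [mul_zero] at this
    refine this.congr' ?_
    filter_upwards [eventually_gt_atTop 0] with n hn
    have : (n : ℝ) ≠ 0 := by positivity
    field_simp
  have h1p : Tendsto (fun n => 1 - p n) atTop (nhds 1) := by simpa using hp0.const_sub 1
  have hW : ∀ n, 0 < p n / (1 - p n) := fun n =>
    div_pos (hp01 n).1 (by linarith [(hp01 n).2])
  have hW0 : Tendsto (fun n => p n / (1 - p n)) atTop (nhds 0) := by
    have := hp0.div h1p one_ne_zero
    rw [zero_div] at this
    exact this
  have hWn : Tendsto (fun n : ℕ => p n / (1 - p n) * n) atTop (nhds lam) := by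
    have := hpn.div h1p one_ne_zero
    rw [div_one] at this
    refine this.congr fun n => by simp only [Pi.div_apply]; ring
  generalize hWdef : (fun n => p n / (1 - p n)) = W at *
  have hWe : ∀ n, p n / (1 - p n) = W n := fun n => congrFun hWdef n
  simp only [hWe] at hW hWn ⊢
  have hr := rr_tendsto lam x hlam hx0 hx W hW hW0 hWn
  have he := err_tendsto lam W hW hW0 hWn 0
  constructor
  · refine hr.congr fun n => ?_
    simp [rr, probBlockSize, genBell_eq_bb]
  · have := (hr.const_sub 1).sub he
    rw [sub_zero] at this
    refine this.congr' ?_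
    filter_upwards [eventually_ge_atTop 2] with n hn
    obtain ⟨m, rfl⟩ : ∃ m, n = m + 2 := ⟨n - 2, by omega⟩
    have p1 := bb_pos (W (m + 2)) (hW _) (m + 1)
    have p2 := bb_pos (W (m + 2)) (hW _) (m + 2)
    simp only [rr, probBlockSize, genBell_eq_bb]
    simp
    field_simp
    ring

/-- in the sparse regime `p_n ~ λ/n`, the clique size of a random vertex of
`CG_{n,p_n}` converges in distribution to a Bernoulli-type law on `{1,2}`; for `λ = 1` the
limit of `P(S = 1)` is the inverse golden ratio. -/
theorem sparse_regime_degrees (lam : ℝ) (hlam : 0 < lam) (p : ℕ → ℝ)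
    (hp01 : ∀ n, p n ∈ Set.Ioo (0 : ℝ) 1)
    (hp : Tendsto (fun n : ℕ => p n * n / lam) atTop (nhds 1)) :
    Tendsto (fun n : ℕ => probBlockSize n 1 (p n / (1 - p n))) atTop
        (nhds ((Real.sqrt (4 * lam + 1) - 1) / (2 * lam))) ∧
    Tendsto (fun n : ℕ => probBlockSize n 2 (p n / (1 - p n))) atTop
        (nhds (1 - (Real.sqrt (4 * lam + 1) - 1) / (2 * lam))) ∧
    (lam = 1 →
      Tendsto (fun n : ℕ => probBlockSize n 1 (p n / (1 - p n))) atTop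
        (nhds (((1 + Real.sqrt 5) / 2)⁻¹))) := by
  have hs : Real.sqrt (4 * lam + 1) ^ 2 = 4 * lam + 1 := Real.sq_sqrt (by linarith)
  have hs1 : 1 < Real.sqrt (4 * lam + 1) := by
    rw [Real.lt_sqrt (by norm_num)]; linarith
  have hx0 : 0 < (Real.sqrt (4 * lam + 1) - 1) / (2 * lam) :=
    div_pos (by linarith) (by linarith)
  have hx : lam * ((Real.sqrt (4 * lam + 1) - 1) / (2 * lam)) ^ 2 +
      (Real.sqrt (4 * lam + 1) - 1) / (2 * lam) = 1 := by
    generalize Real.sqrt (4 * lam + 1) = s at *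
    field_simp
    nlinarith
  obtain ⟨h1, h2⟩ := sparse_aux lam hlam p hp01 hp _ hx0 hx
  refine ⟨h1, h2, ?_⟩
  rintro rfl
  have h5 : Real.sqrt 5 ^ 2 = 5 := Real.sq_sqrt (by norm_num)
  refine (sparse_aux 1 hlam p hp01 hp _ (by positivity) ?_).1
  field_simp
  nlinarith
end

section
/- Let d ∈ ℕ ∪ {0} and p_n = n^{-2/(d+1)^2 + o(1)}. Then for the random cluster graph CG_{n,p_n}, the degree D_{n,p_n} of a uniformly random vertex satisfies P(D_{n,p_n} = d) → 1 as n → ∞, and moreover for any d' ≠ d, P(D_{n,p_n} = d') = n^{-((d'-d)/(d+1))^2 + o(1)}. -/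
open Finset

open Filter

/-- `P(D_{n,p} = d)`: the degree distribution of the random cluster graph, `w = p/(1-p)`. -/
noncomputable def probDegree (n d : ℕ) (w : ℝ) : ℝ :=
  ((n - 1).choose d : ℝ) * w ^ (d + 1).choose 2 * genBell (n - d - 1) w / genBell n w

/-! ### Combinatorial recurrence -/

/-- weighted count of partitions of a finset -/
noncomputable def gbSet {α : Type*} [DecidableEq α] (s : Finset α) (w : ℝ) : ℝ :=
  ∑ P : Finpartition s, ∏ S ∈ P.parts, w ^ (S.card).choose 2

/-- the sequence defined by the block recurrence -/
noncomputable def bellRec (w : ℝ) : ℕ → ℝ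
  | 0 => 1
  | n + 1 => ∑ k : Fin (n + 1),
      (n.choose k : ℝ) * w ^ ((k : ℕ) + 1).choose 2 * bellRec w (n - k)
  decreasing_by omega

lemma bellRec_succ (w : ℝ) (n : ℕ) : bellRec w (n + 1) = ∑ k ∈ range (n + 1),
      (n.choose k : ℝ) * w ^ (k + 1).choose 2 * bellRec w (n - k) := by
  rw [bellRec, Finset.sum_range]

lemma gbSet_insert {α : Type*} [DecidableEq α] (w : ℝ) (a : α) (t : Finset α) (ha : a ∉ t) :
    gbSet (insert a t) w =
      ∑ u ∈ t.powerset, w ^ (u.card + 1).choose 2 * gbSet (t \ u) w := by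
  unfold gbSet
  rw [← Finset.sum_fiberwise_of_maps_to (s := univ) (t := t.powerset)
    (g := fun P : Finpartition (insert a t) => (P.part a).erase a)]
  · refine Finset.sum_congr rfl fun u hu => ?_
    rw [Finset.mem_powerset] at hu
    have hau : a ∉ u := fun h => ha (hu h)
    have hdisj : Disjoint (t \ u) (insert a u) := by
      rw [Finset.disjoint_left]
      intro x hx hx'
      simp only [Finset.mem_sdiff, Finset.mem_insert] at hx hx'
      rcases hx' with rfl | h
      · exact ha hx.1
      · exact hx.2 h
    have hsup : (t \ u) ⊔ (insert a u) = insert a t := by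
      ext x
      simp only [Finset.sup_eq_union, Finset.mem_union, Finset.mem_sdiff, Finset.mem_insert]
      have := @hu x
      tauto
    have hne : insert a u ≠ (⊥ : Finset α) := Finset.insert_ne_empty a u
    have hnot : ∀ Q : Finpartition (t \ u), insert a u ∉ Q.parts := by
      intro Q h
      have := Q.subset h (Finset.mem_insert_self a u)
      exact ha (Finset.mem_sdiff.1 this).1
    rw [Finset.mul_sum]
    symm
    refine Finset.sum_bij (fun Q _ => Q.extend hne hdisj hsup) ?_ ?_ ?_ ?_
    · intro Q _
      simp only [Finset.mem_filter, Finset.mem_univ, true_and]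
      rw [Finpartition.part_eq_of_mem (t := insert a u)]
      · exact Finset.erase_insert hau
      · simp [Finpartition.extend]
      · exact Finset.mem_insert_self a u
    · intro Q _ Q' _ h
      have h2 : insert (insert a u) Q.parts = insert (insert a u) Q'.parts :=
        congrArg Finpartition.parts h
      apply Finpartition.ext
      rw [← Finset.erase_insert (hnot Q), h2, Finset.erase_insert (hnot Q')]
    · intro P hP
      simp only [Finset.mem_filter, Finset.mem_univ, true_and] at hP
      have hap : a ∈ P.part a := P.mem_part (Finset.mem_insert_self a t)
      have hpart : P.part a = insert a u := by
        rw [← hP, Finset.insert_erase hap]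
      have hmem : insert a u ∈ P.parts := by
        rw [← hpart]; exact P.part_mem.2 (Finset.mem_insert_self a t)
      have hs : (P.parts.erase (insert a u)).sup id = t \ u := by
        have h1 : Disjoint (insert a u) ((P.parts.erase (insert a u)).sup id) :=
          P.supIndep (Finset.erase_subset _ _) hmem (Finset.notMem_erase _ _)
        have h2 : (insert a u) ∪ ((P.parts.erase (insert a u)).sup id) = insert a t := by
          have := P.sup_parts
          rw [← Finset.insert_erase hmem, Finset.sup_insert] at this
          exact this
        ext x
        have h3 : x ∈ insert a u → x ∉ (P.parts.erase (insert a u)).sup id :=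
          fun h => Finset.disjoint_left.1 h1 h
        have h4 := Finset.ext_iff.1 h2 x
        simp only [Finset.mem_union, Finset.mem_insert, Finset.mem_sdiff] at h3 h4 ⊢
        by_cases hx : x = a
        · subst hx; tauto
        · tauto
      refine ⟨P.ofSubset (Finset.erase_subset _ _) hs, Finset.mem_univ _, ?_⟩
      apply Finpartition.ext
      exact Finset.insert_erase hmem
    · intro Q _
      simp only [Finpartition.extend]
      rw [Finset.prod_insert (hnot Q), Finset.card_insert_of_notMem hau]
  · intro P _
    rw [Finset.mem_powerset]
    intro x hx
    rw [Finset.mem_erase] at hx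
    have := P.part_subset a hx.2
    rw [Finset.mem_insert] at this
    tauto

lemma gbSet_eq {α : Type*} [DecidableEq α] (w : ℝ) : ∀ (n : ℕ) (s : Finset α), s.card = n →
    gbSet s w = bellRec w n := by
  intro n
  induction n using Nat.strong_induction_on with
  | _ n ih =>
    intro s hs
    rcases s.eq_empty_or_nonempty with rfl | ⟨a, ha⟩
    · simp only [Finset.card_empty] at hs
      subst hs
      have : gbSet (⊥ : Finset α) w = 1 := by
        unfold gbSet
        rw [Fintype.sum_unique, Finpartition.parts_eq_empty_iff.2 rfl, Finset.prod_empty]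
      rw [bellRec]
      exact this
    · obtain ⟨m, rfl⟩ : ∃ m, n = m + 1 :=
        ⟨n - 1, by have := Finset.card_pos.2 ⟨a, ha⟩; omega⟩
      have hcard : (s.erase a).card = m := by rw [Finset.card_erase_of_mem ha]; omega
      rw [← Finset.insert_erase ha, gbSet_insert w a _ (Finset.notMem_erase a s), bellRec_succ]
      rw [← hcard]
      have := Finset.sum_powerset_apply_card (x := s.erase a)
        (fun k => w ^ (k + 1).choose 2 * bellRec w ((s.erase a).card - k))
      calc _ = ∑ u ∈ (s.erase a).powerset,
            w ^ (u.card + 1).choose 2 * bellRec w ((s.erase a).card - u.card) := by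
            refine Finset.sum_congr rfl fun u hu => ?_
            rw [Finset.mem_powerset] at hu
            rw [ih ((s.erase a).card - u.card) (by omega) _ (Finset.card_sdiff_of_subset hu)]
        _ = _ := by
            rw [this]
            refine Finset.sum_congr rfl fun k _ => ?_
            rw [nsmul_eq_mul, mul_assoc]

lemma genBell_eq (n : ℕ) (w : ℝ) : genBell n w = bellRec w n :=
  gbSet_eq w n (univ : Finset (Fin n)) (by simp)

/-! ### Log-convexity (Bender-Canfield) -/

lemma cheb_aux (m : ℕ) (r T U : ℕ → ℝ)
    (h : ∀ i j, i < j → j < m → r j ≤ r i ∧ T i * U j ≤ T j * U i) :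
    (∑ j ∈ range m, r j * T j) * (∑ j ∈ range m, U j) ≤
      (∑ j ∈ range m, r j * U j) * (∑ j ∈ range m, T j) := by
  have key : ∑ i ∈ range m, ∑ j ∈ range m, (r i - r j) * (T i * U j - T j * U i) ≤ 0 := by
    refine Finset.sum_nonpos fun i hi => Finset.sum_nonpos fun j hj => ?_
    rw [Finset.mem_range] at hi hj
    rcases lt_trichotomy i j with hij | rfl | hij
    · obtain ⟨h1, h2⟩ := h i j hij hj
      nlinarith
    · simp
    · obtain ⟨h1, h2⟩ := h j i hij hi
      nlinarith
  have e1 : ∑ i ∈ range m, ∑ j ∈ range m, (r i - r j) * (T i * U j - T j * U i) =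
      2 * ((∑ j ∈ range m, r j * T j) * (∑ j ∈ range m, U j) -
      (∑ j ∈ range m, r j * U j) * (∑ j ∈ range m, T j)) := by
    have : ∀ i j, (r i - r j) * (T i * U j - T j * U i) =
      ((r i * T i) * U j - (r i * U i) * T j) + (U i * (r j * T j) - T i * (r j * U j)) := by
      intro i j; ring
    simp only [this, Finset.sum_add_distrib, Finset.sum_sub_distrib, ← Finset.mul_sum,
      ← Finset.sum_mul]
    ring
  linarith

section BC
variable (y b : ℕ → ℝ)

lemma bc_logconcave (hy : ∀ j, 0 < y j) (hb : ∀ j, 0 < b j) (hy0 : y 0 = 1)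
    (hy1 : ∀ j, y (j + 1) ≤ y j)
    (hyl : ∀ i j, i ≤ j → y (j + 1) / y j ≤ y (i + 1) / y i)
    (hrec : ∀ n : ℕ, ((n : ℝ) + 1) * b (n + 1) = ∑ j ∈ range (n + 1), y j * b (n - j)) :
    ∀ q p, p ≤ q → b (q + 1) * b p ≤ b (p + 1) * b q := by
  intro q
  induction q using Nat.strong_induction_on with
  | _ q ih =>
    have hstep : ∀ n : ℕ, ((n : ℝ) + 1) * b (n + 1) =
        b n + ∑ j ∈ range n, y (j + 1) * b (n - 1 - j) := by
      intro n
      rw [hrec, Finset.sum_range_succ', hy0]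
      simp only [Nat.sub_zero, one_mul]
      rw [add_comm]
      congr 1
      refine Finset.sum_congr rfl fun j _ => ?_
      rw [Nat.sub_sub, add_comm 1 j]
    -- consecutive case
    have hcons : ∀ m, q = m + 1 → b (m + 2) * b m ≤ b (m + 1) * b (m + 1) := by
      rintro m rfl
      rcases Nat.eq_zero_or_pos m with rfl | hm
      · have h1 := hstep 0
        have h2 := hstep 1
        have h3 := hy1 0
        simp only [Finset.range_zero, Finset.sum_empty, Finset.sum_range_one] at h1 h2
        norm_num at h1 h2 h3
        rw [hy0] at h3
        have := hb 0
        rw [h1] at h2 ⊢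
        nlinarith [mul_pos this this]
      · obtain ⟨l, rfl⟩ : ∃ l, m = l + 1 := ⟨m - 1, by omega⟩
        set N1 := ∑ j ∈ range (l + 2), y (j + 1) * b (l + 1 - j) with hN1
        set N0 := ∑ j ∈ range (l + 1), y (j + 1) * b (l - j) with hN0
        have s2 : ((l : ℝ) + 3) * b (l + 3) = b (l + 2) + N1 := by
          have := hstep (l + 2)
          push_cast at this
          rw [show (l : ℝ) + 3 = l + 2 + 1 by ring]
          exact this
        have s1 : ((l : ℝ) + 2) * b (l + 2) = b (l + 1) + N0 := by
          have := hstep (l + 1)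
          push_cast at this
          rw [show (l : ℝ) + 2 = l + 1 + 1 by ring]
          exact this
        have d1 : ((l : ℝ) + 2) * b (l + 2) = ∑ j ∈ range (l + 2), y j * b (l + 1 - j) := by
          have := hrec (l + 1)
          push_cast at this
          rw [show (l : ℝ) + 2 = l + 1 + 1 by ring]
          exact this
        have d0 : ((l : ℝ) + 1) * b (l + 1) = ∑ j ∈ range (l + 1), y j * b (l - j) := hrec l
        have hN0le : N0 ≤ ((l : ℝ) + 1) * b (l + 1) := by
          rw [d0]
          exact Finset.sum_le_sum fun j _ => mul_le_mul_of_nonneg_right (hy1 j) (hb _).le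
        have hch := cheb_aux (l + 2) (fun j => y (j + 1) / y j) (fun j => y j * b (l + 1 - j))
          (fun j => if j < l + 1 then y j * b (l - j) else 0) (by
            intro i j hij hj
            refine ⟨hyl i j hij.le, ?_⟩
            rw [if_pos (show i < l + 1 by omega)]
            split_ifs with hj2
            · have := ih (l - i) (by omega) (l - j) (by omega)
              rw [show l - i + 1 = l + 1 - i by omega, show l - j + 1 = l + 1 - j by omega] at this
              have hp := mul_pos (hy i) (hy j)
              nlinarith
            · have := hb (l + 1 - j)
              have := hb (l - i)
              have := hy i
              have := hy j
              rw [mul_zero]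
              positivity)
        have c1 : ∑ j ∈ range (l + 2), y (j + 1) / y j * (y j * b (l + 1 - j)) = N1 := by
          refine Finset.sum_congr rfl fun j _ => ?_
          rw [← mul_assoc, div_mul_cancel₀ _ (hy j).ne']
        have c2 : ∑ j ∈ range (l + 2), (if j < l + 1 then y j * b (l - j) else 0) =
            ((l : ℝ) + 1) * b (l + 1) := by
          rw [d0, Finset.sum_range_succ, if_neg (by omega), add_zero]
          refine Finset.sum_congr rfl fun j hj => ?_
          rw [if_pos (Finset.mem_range.1 hj)]
        have c3 : ∑ j ∈ range (l + 2), y (j + 1) / y j *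
            (if j < l + 1 then y j * b (l - j) else 0) = N0 := by
          rw [Finset.sum_range_succ, if_neg (by omega), mul_zero, add_zero]
          refine Finset.sum_congr rfl fun j hj => ?_
          rw [if_pos (Finset.mem_range.1 hj), ← mul_assoc, div_mul_cancel₀ _ (hy j).ne']
        rw [c1, c2, c3, ← d1] at hch
        have hb1 := hb (l + 1)
        have hb2 := hb (l + 2)
        have hl : (0 : ℝ) ≤ l := Nat.cast_nonneg l
        have hle : b (l + 2) ≤ b (l + 1) := by
          have : ((l : ℝ) + 2) * b (l + 2) ≤ ((l : ℝ) + 2) * b (l + 1) := by linarith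
          exact le_of_mul_le_mul_left this (by linarith)
        have hN0' : N0 = ((l : ℝ) + 2) * b (l + 2) - b (l + 1) := by linarith
        have hfin : (((l : ℝ) + 1) * (l + 3)) * (b (l + 3) * b (l + 1)) ≤
            (((l : ℝ) + 1) * (l + 3)) * (b (l + 2) * b (l + 2)) := by
          have e1 : (((l : ℝ) + 1) * (l + 3)) * (b (l + 3) * b (l + 1)) =
            (l + 1) * b (l + 1) * b (l + 2) + N1 * ((l + 1) * b (l + 1)) := by
            rw [show (((l : ℝ) + 1) * (l + 3)) * (b (l + 3) * b (l + 1)) =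
              (((l : ℝ) + 3) * b (l + 3)) * ((l + 1) * b (l + 1)) by ring, s2]
            ring
          rw [e1]
          rw [hN0'] at hch
          have := mul_le_mul_of_nonneg_left hle hb2.le
          nlinarith
        exact le_of_mul_le_mul_left hfin (by positivity)
    intro p hp
    rcases Nat.eq_or_lt_of_le hp with rfl | hlt
    · exact le_rfl
    · obtain ⟨m, rfl⟩ : ∃ m, q = m + 1 := ⟨q - 1, by omega⟩
      have h1 := hcons m rfl
      have h2 := ih m (by omega) p (by omega)
      have hA := hb (m + 2)
      have hB := hb (m + 1)
      have hC := hb m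
      have hD := hb p
      have hE := hb (p + 1)
      have h3 : (b (m + 1) * b m) * (b (m + 1 + 1) * b p) ≤
          (b (m + 1) * b m) * (b (p + 1) * b (m + 1)) := by
        calc _ = (b (m + 2) * b m) * (b (m + 1) * b p) := by ring
          _ ≤ (b (m + 1) * b (m + 1)) * (b (p + 1) * b m) :=
            mul_le_mul h1 h2 (by positivity) (by positivity)
          _ = _ := by ring
      exact le_of_mul_le_mul_left h3 (by positivity)

lemma bc_logconvex (hy : ∀ j, 0 < y j) (hb : ∀ j, 0 < b j) (hy0 : y 0 = 1)
    (hy1 : ∀ j, y (j + 1) ≤ y j)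
    (hyl : ∀ i j, i ≤ j → y (j + 1) / y j ≤ y (i + 1) / y i)
    (hrec : ∀ n : ℕ, ((n : ℝ) + 1) * b (n + 1) = ∑ j ∈ range (n + 1), y j * b (n - j)) (m : ℕ) :
    ((m : ℝ) + 1) * b (m + 1) * b (m + 1) ≤ ((m : ℝ) + 2) * b (m + 2) * b m := by
  have hlc := bc_logconcave y b hy hb hy0 hy1 hyl hrec
  have h2 := hrec (m + 1)
  push_cast at h2
  rw [show (m : ℝ) + 2 = m + 1 + 1 by ring, h2, hrec m, Finset.sum_range_succ _ (m + 1), add_mul,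
    Finset.sum_mul, Finset.sum_mul]
  have : 0 ≤ y (m + 1) * b (m + 1 - (m + 1)) * b m := by
    have := hy (m + 1); have := hb (m + 1 - (m + 1)); have := hb m
    positivity
  refine le_trans (Finset.sum_le_sum fun j hj => ?_) (le_add_of_nonneg_right this)
  rw [Finset.mem_range] at hj
  have h := hlc m (m - j) (by omega)
  rw [show m - j + 1 = m + 1 - j by omega] at h
  have := hy j
  nlinarith
end BC

lemma bellRec_pos {w : ℝ} (hw : 0 < w) : ∀ n, 0 < bellRec w n := by
  intro n
  induction n using Nat.strong_induction_on with
  | _ n ih =>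
    rcases n with _ | n
    · simp [bellRec]
    · rw [bellRec_succ]
      refine Finset.sum_pos (fun k hk => ?_) ⟨0, by simp⟩
      rw [Finset.mem_range] at hk
      have h1 := ih (n - k) (by omega)
      have h2 : 0 < n.choose k := Nat.choose_pos (by omega)
      positivity

lemma bellRec_logconvex {w : ℝ} (hw : 0 < w) (hw1 : w ≤ 1) (m : ℕ) :
    bellRec w (m + 1) * bellRec w (m + 1) ≤ bellRec w m * bellRec w (m + 2) := by
  have hrat : ∀ j : ℕ, (w ^ (j + 1 + 1).choose 2 / ((j + 1).factorial : ℝ)) =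
      (w ^ (j + 1).choose 2 / (j.factorial : ℝ)) * (w ^ (j + 1) / ((j : ℝ) + 1)) := by
    intro j
    rw [Nat.choose_succ_succ' (j + 1) 1, Nat.choose_one_right, pow_add, Nat.factorial_succ]
    have : (j.factorial : ℝ) ≠ 0 := by positivity
    push_cast
    field_simp
  have hypos : ∀ j : ℕ, 0 < w ^ (j + 1).choose 2 / (j.factorial : ℝ) := fun j => by positivity
  have h := bc_logconvex (fun j => w ^ (j + 1).choose 2 / (j.factorial : ℝ))
    (fun j => bellRec w j / (j.factorial : ℝ)) hypos
    (fun j => by have := bellRec_pos hw j; positivity) (by simp)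
    (fun j => by
      rw [hrat]
      refine mul_le_of_le_one_right (hypos j).le ?_
      rw [div_le_one (by positivity)]
      have : w ^ (j + 1) ≤ 1 := pow_le_one₀ hw.le hw1
      have : (0 : ℝ) ≤ j := Nat.cast_nonneg j
      linarith)
    (fun i j hij => by
      rw [hrat, hrat, mul_div_cancel_left₀ _ (hypos j).ne', mul_div_cancel_left₀ _ (hypos i).ne']
      have h1 : w ^ (j + 1) ≤ w ^ (i + 1) := pow_le_pow_of_le_one hw.le hw1 (by omega)
      have h2 : (i : ℝ) ≤ j := by exact_mod_cast hij
      gcongr)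
    (fun n => by
      rw [bellRec_succ, Nat.factorial_succ]
      push_cast
      rw [← mul_div_assoc, mul_div_mul_left _ _ (by positivity), Finset.sum_div]
      refine Finset.sum_congr rfl fun k hk => ?_
      rw [Finset.mem_range] at hk
      rw [Nat.cast_choose ℝ (show k ≤ n by omega)]
      have : (n.factorial : ℝ) ≠ 0 := by positivity
      have : (k.factorial : ℝ) ≠ 0 := by positivity
      have : ((n - k).factorial : ℝ) ≠ 0 := by positivity
      field_simp) m
  rw [Nat.factorial_succ (m + 1), Nat.factorial_succ m] at h
  push_cast at h
  have hf : (0 : ℝ) < m.factorial := by positivity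
  have e1 : ((m : ℝ) + 1) * (bellRec w (m + 1) / (((m : ℝ) + 1) * m.factorial)) *
      (bellRec w (m + 1) / (((m : ℝ) + 1) * m.factorial)) =
      (bellRec w (m + 1) * bellRec w (m + 1)) / (((m : ℝ) + 1) * m.factorial * m.factorial) := by
    field_simp
  have e2 : ((m : ℝ) + 2) * (bellRec w (m + 2) / (((m : ℝ) + 1 + 1) *
      (((m : ℝ) + 1) * m.factorial))) * (bellRec w m / m.factorial) =
      (bellRec w m * bellRec w (m + 2)) / (((m : ℝ) + 1) * m.factorial * m.factorial) := by
    rw [show (m : ℝ) + 1 + 1 = m + 2 by ring]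
    field_simp
  rw [e1, e2] at h
  exact (div_le_div_iff_of_pos_right (by positivity)).1 h

/-! ### Increments of the logarithm -/

/-- logarithm of the weighted Bell number -/
noncomputable def lb (w : ℝ) (m : ℕ) : ℝ := Real.log (bellRec w m)

lemma lb_convex {w : ℝ} (hw : 0 < w) (hw1 : w ≤ 1) (m : ℕ) :
    lb w (m + 1) - lb w m ≤ lb w (m + 2) - lb w (m + 1) := by
  have h := bellRec_logconvex hw hw1 m
  have h0 := bellRec_pos hw m
  have h1 := bellRec_pos hw (m + 1)
  have h2 := bellRec_pos hw (m + 2)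
  have := Real.log_le_log (mul_pos h1 h1) h
  rw [Real.log_mul h1.ne' h1.ne', Real.log_mul h0.ne' h2.ne'] at this
  unfold lb
  linarith

lemma lb_mono {w : ℝ} (hw : 0 < w) (hw1 : w ≤ 1) :
    Monotone (fun m => lb w (m + 1) - lb w m) :=
  monotone_nat_of_le_succ (lb_convex hw hw1)

lemma lb_lower {w : ℝ} (hw : 0 < w) (hw1 : w ≤ 1) (m k : ℕ) :
    (k : ℝ) * (lb w (m + 1) - lb w m) ≤ lb w (m + k) - lb w m := by
  induction k with
  | zero => simp
  | succ k ih =>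
    have := lb_mono hw hw1 (show m ≤ m + k by omega)
    simp only at this
    push_cast
    rw [← add_assoc m k 1]
    linarith

lemma lb_upper {w : ℝ} (hw : 0 < w) (hw1 : w ≤ 1) (m k : ℕ) :
    lb w (m + k + 1) - lb w m ≤ ((k : ℝ) + 1) * (lb w (m + k + 1) - lb w (m + k)) := by
  induction k with
  | zero => simp
  | succ k ih =>
    have h := lb_mono hw hw1 (show m + k ≤ m + (k + 1) by omega)
    simp only at h
    push_cast
    rw [← add_assoc m k 1] at *
    have hk : (0 : ℝ) ≤ (k : ℝ) + 1 := by positivity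
    have := mul_le_mul_of_nonneg_left h hk
    linarith

lemma bellRec_mono {w : ℝ} (hw : 0 < w) : Monotone (bellRec w) := by
  refine monotone_nat_of_le_succ fun n => ?_
  rw [bellRec_succ]
  have := Finset.single_le_sum (f := fun k => (n.choose k : ℝ) * w ^ (k + 1).choose 2 *
    bellRec w (n - k)) (s := range (n + 1))
    (fun k _ => by have := bellRec_pos hw (n - k); positivity) (show 0 ∈ range (n + 1) by simp)
  simpa using this

lemma lb_term {w : ℝ} (hw : 0 < w) (hw1 : w ≤ 1) (m d : ℕ) (hd : d ≤ m) :
    (Real.log (m.choose d) + ((d + 1).choose 2 : ℕ) * Real.log w) / ((d : ℝ) + 1) ≤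
      lb w (m + 1) - lb w m := by
  obtain ⟨r, rfl⟩ : ∃ r, m = r + d := ⟨m - d, by omega⟩
  have h1 := Finset.single_le_sum (f := fun k => ((r + d).choose k : ℝ) * w ^ (k + 1).choose 2 *
    bellRec w (r + d - k)) (s := range (r + d + 1))
    (fun k _ => by have := bellRec_pos hw (r + d - k); positivity)
    (show d ∈ range (r + d + 1) by simp)
  rw [← bellRec_succ] at h1
  simp only [Nat.add_sub_cancel] at h1
  have hr := bellRec_pos hw r
  have hc : (0 : ℝ) < ((r + d).choose d : ℕ) := by
    exact_mod_cast Nat.choose_pos (by omega)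
  have h2 := Real.log_le_log (by positivity) h1
  rw [Real.log_mul (by positivity) hr.ne', Real.log_mul hc.ne' (by positivity),
    Real.log_pow] at h2
  have h3 := lb_upper hw hw1 r d
  rw [div_le_iff₀ (by positivity)]
  unfold lb at *
  linarith

lemma probDegree_pos {w : ℝ} (hw : 0 < w) {n k : ℕ} (hn : k + 1 ≤ n) : 0 < probDegree n k w := by
  unfold probDegree
  rw [genBell_eq, genBell_eq]
  have := bellRec_pos hw (n - k - 1)
  have := bellRec_pos hw n
  have : 0 < (n - 1).choose k := Nat.choose_pos (by omega)
  positivity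

lemma log_probDegree {w : ℝ} (hw : 0 < w) {n k : ℕ} (hn : k + 1 ≤ n) :
    Real.log (probDegree n k w) = Real.log ((n - 1).choose k) +
      ((k + 1).choose 2 : ℕ) * Real.log w - (lb w n - lb w (n - (k + 1))) := by
  unfold probDegree lb
  rw [genBell_eq, genBell_eq]
  have h1 := bellRec_pos hw (n - k - 1)
  have h2 := bellRec_pos hw n
  have h3 : (0 : ℝ) < ((n - 1).choose k : ℕ) := by
    exact_mod_cast Nat.choose_pos (by omega)
  rw [Real.log_div (by positivity) h2.ne', Real.log_mul (by positivity) h1.ne',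
    Real.log_mul h3.ne' (by positivity), Real.log_pow, Nat.sub_sub]
  ring

lemma sum_probDegree {w : ℝ} (hw : 0 < w) {n : ℕ} (hn : 1 ≤ n) :
    ∑ k ∈ range n, probDegree n k w = 1 := by
  obtain ⟨m, rfl⟩ : ∃ m, n = m + 1 := ⟨n - 1, by omega⟩
  unfold probDegree
  rw [← Finset.sum_div, genBell_eq, div_eq_one_iff_eq (bellRec_pos hw _).ne', bellRec_succ]
  refine Finset.sum_congr rfl fun k _ => ?_
  rw [genBell_eq, Nat.add_sub_cancel, show m + 1 - k - 1 = m - k by omega]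

lemma probDegree_le {w : ℝ} (hw : 0 < w) (n k : ℕ) :
    probDegree n k w ≤ (n : ℝ) ^ k * w ^ (k + 1).choose 2 := by
  unfold probDegree
  rw [genBell_eq, genBell_eq, mul_div_assoc]
  have h2 := bellRec_pos hw n
  have h1 : bellRec w (n - k - 1) / bellRec w n ≤ 1 := by
    rw [div_le_one h2]
    exact bellRec_mono hw (by omega)
  have h3 : ((n - 1).choose k : ℝ) ≤ (n : ℝ) ^ k := by
    have : (n - 1).choose k ≤ n ^ k :=
      (Nat.choose_le_pow _ _).trans (Nat.pow_le_pow_left (by omega) _)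
    exact_mod_cast this
  calc _ ≤ ((n - 1).choose k : ℝ) * w ^ (k + 1).choose 2 :=
        mul_le_of_le_one_right (by positivity) h1
    _ ≤ _ := by gcongr

/-! ### Asymptotics -/

lemma tendsto_log_nat : Tendsto (fun n : ℕ => Real.log n) atTop atTop :=
  Real.tendsto_log_atTop.comp tendsto_natCast_atTop_atTop

lemma log_choose_tendsto (k j : ℕ) :
    Tendsto (fun n : ℕ => Real.log ((n - k).choose j : ℕ) / Real.log n) atTop (nhds (j : ℝ)) := by
  have hlow : Tendsto (fun n : ℕ => (j : ℝ) - ((j : ℝ) * Real.log 2 + Real.log j.factorial) /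
      Real.log n) atTop (nhds (j : ℝ)) := by
    have := (tendsto_log_nat.const_div_atTop
      ((j : ℝ) * Real.log 2 + Real.log j.factorial)).const_sub (j : ℝ)
    simpa using this
  refine tendsto_of_tendsto_of_tendsto_of_le_of_le' hlow tendsto_const_nhds ?_ ?_
  · filter_upwards [eventually_ge_atTop (2 * (k + j) + 2)] with n hn
    have hn1 : (1 : ℝ) < n := by exact_mod_cast (by omega : 1 < n)
    have hl : 0 < Real.log n := Real.log_pos hn1
    have hf : (0 : ℝ) < j.factorial := by positivity
    have h1 := Nat.pow_le_choose (α := ℝ) j (n - k)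
    have h2 : (n : ℝ) / 2 ≤ ((n - k + 1 - j : ℕ) : ℝ) := by
      rw [div_le_iff₀ (by norm_num)]
      exact_mod_cast (by omega : n ≤ (n - k + 1 - j) * 2)
    have h3 : ((n : ℝ) / 2) ^ j / j.factorial ≤ ((n - k).choose j : ℕ) :=
      le_trans (by gcongr) h1
    have h4 := Real.log_le_log (by positivity) h3
    rw [Real.log_div (by positivity) hf.ne', Real.log_pow,
      Real.log_div (by positivity) (by norm_num)] at h4
    rw [le_div_iff₀ hl, sub_mul, div_mul_cancel₀ _ hl.ne']
    linarith
  · filter_upwards [eventually_ge_atTop (2 * (k + j) + 2)] with n hn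
    have hn1 : (1 : ℝ) < n := by exact_mod_cast (by omega : 1 < n)
    have hl : 0 < Real.log n := Real.log_pos hn1
    have hc : (0 : ℝ) < ((n - k).choose j : ℕ) := by
      exact_mod_cast Nat.choose_pos (by omega)
    have h3 : ((n - k).choose j : ℝ) ≤ (n : ℝ) ^ j := by
      have : (n - k).choose j ≤ n ^ j :=
        (Nat.choose_le_pow _ _).trans (Nat.pow_le_pow_left (by omega) _)
      exact_mod_cast this
    have h4 := Real.log_le_log hc h3
    rw [Real.log_pow] at h4
    rwa [div_le_iff₀ hl]

/-- the lower bound for the increments -/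
noncomputable def lam (d : ℕ) (w : ℕ → ℝ) (k n : ℕ) : ℝ :=
  (Real.log ((n - k).choose d : ℕ) + ((d + 1).choose 2 : ℕ) * Real.log (w n)) / ((d : ℝ) + 1)

section Core
variable (d : ℕ) (w : ℕ → ℝ)

lemma lam_tendsto (hw : Tendsto (fun n : ℕ => Real.log (w n) / Real.log n) atTop
      (nhds (-2 / ((d : ℝ) + 1) ^ 2))) (k : ℕ) :
    Tendsto (fun n : ℕ => lam d w k n / Real.log n) atTop
      (nhds (((d : ℝ) / ((d : ℝ) + 1)) ^ 2)) := by
  have h := ((log_choose_tendsto k d).add (hw.const_mul (((d + 1).choose 2 : ℕ) : ℝ))).div_const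
    ((d : ℝ) + 1)
  have hd : (d : ℝ) + 1 ≠ 0 := by positivity
  have e : ((d : ℝ) + (((d + 1).choose 2 : ℕ) : ℝ) * (-2 / ((d : ℝ) + 1) ^ 2)) / ((d : ℝ) + 1) =
      ((d : ℝ) / ((d : ℝ) + 1)) ^ 2 := by
    rw [Nat.cast_choose_two]
    push_cast
    field_simp
    ring
  rw [e] at h
  refine h.congr fun n => ?_
  unfold lam
  ring

lemma base_tendsto (hw : Tendsto (fun n : ℕ => Real.log (w n) / Real.log n) atTop
      (nhds (-2 / ((d : ℝ) + 1) ^ 2))) (k : ℕ) :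
    Tendsto (fun n : ℕ => (Real.log ((n - 1).choose k : ℕ) +
      ((k + 1).choose 2 : ℕ) * Real.log (w n)) / Real.log n) atTop
      (nhds ((k : ℝ) - ((k : ℝ) + 1) * k / ((d : ℝ) + 1) ^ 2)) := by
  have h := (log_choose_tendsto 1 k).add (hw.const_mul (((k + 1).choose 2 : ℕ) : ℝ))
  have e : (k : ℝ) + (((k + 1).choose 2 : ℕ) : ℝ) * (-2 / ((d : ℝ) + 1) ^ 2) =
      (k : ℝ) - ((k : ℝ) + 1) * k / ((d : ℝ) + 1) ^ 2 := by
    rw [Nat.cast_choose_two]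
    push_cast
    field_simp
    ring
  rw [e] at h
  refine h.congr fun n => ?_
  ring

lemma exponent_eq (k : ℝ) : (k - (k + 1) * k / ((d : ℝ) + 1) ^ 2) -
    (k + 1) * ((d : ℝ) / ((d : ℝ) + 1)) ^ 2 = -((k - d) / ((d : ℝ) + 1)) ^ 2 := by
  have hd : (d : ℝ) + 1 ≠ 0 := by positivity
  field_simp
  ring

theorem core (hw0 : ∀ n, 0 < w n)
    (hw : Tendsto (fun n : ℕ => Real.log (w n) / Real.log n) atTop
      (nhds (-2 / ((d : ℝ) + 1) ^ 2))) :
    Tendsto (fun n : ℕ => probDegree n d (w n)) atTop (nhds 1) ∧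
    ∀ d' : ℕ, d' ≠ d →
      Tendsto (fun n : ℕ => Real.log (probDegree n d' (w n)) / Real.log n) atTop
        (nhds (-(((d' : ℝ) - d) / ((d : ℝ) + 1)) ^ 2)) := by
  have hd1 : (0 : ℝ) < (d : ℝ) + 1 := by positivity
  -- smallness of `w`
  have hsmall : ∀ᶠ n : ℕ in atTop, (w n) ^ ((d + 1) ^ 2) ≤ 1 / (n : ℝ) := by
    have hlt : (-2 / ((d : ℝ) + 1) ^ 2) < -1 / ((d : ℝ) + 1) ^ 2 := by
      gcongr; norm_num
    filter_upwards [hw.eventually (gt_mem_nhds hlt), eventually_gt_atTop 1] with n h hn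
    have hn1 : (1 : ℝ) < n := by exact_mod_cast hn
    have hl : 0 < Real.log n := Real.log_pos hn1
    rw [div_lt_iff₀ hl] at h
    rw [← Real.log_le_log_iff (pow_pos (hw0 n) _) (by positivity), Real.log_pow,
      Real.log_div one_ne_zero (by positivity), Real.log_one, zero_sub]
    push_cast
    have : ((d : ℝ) + 1) ^ 2 * Real.log (w n) ≤
        ((d : ℝ) + 1) ^ 2 * (-1 / ((d : ℝ) + 1) ^ 2 * Real.log n) :=
      mul_le_mul_of_nonneg_left h.le (by positivity)
    refine this.trans (le_of_eq ?_)
    field_simp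
  have hw1 : ∀ᶠ n : ℕ in atTop, w n ≤ 1 := by
    filter_upwards [hsmall, eventually_gt_atTop 1] with n h hn
    have hn1 : (1 : ℝ) < n := by exact_mod_cast hn
    by_contra hc
    push Not at hc
    have h1 : 1 ≤ (w n) ^ ((d + 1) ^ 2) := one_le_pow₀ hc.le
    have h2 : 1 / (n : ℝ) < 1 := by rw [div_lt_one (by linarith)]; exact hn1
    linarith
  -- upper bound
  have hlamle : ∀ k, ∀ᶠ n : ℕ in atTop,
      lam d w (k + 1) n ≤ lb (w n) (n - (k + 1) + 1) - lb (w n) (n - (k + 1)) := by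
    intro k
    filter_upwards [hw1, eventually_ge_atTop (k + 1 + d)] with n h1 hn
    exact lb_term (hw0 n) h1 (n - (k + 1)) d (by omega)
  have hup : ∀ k, ∀ᶠ n : ℕ in atTop, Real.log (probDegree n k (w n)) ≤
      (Real.log ((n - 1).choose k : ℕ) + ((k + 1).choose 2 : ℕ) * Real.log (w n)) -
        ((k : ℝ) + 1) * lam d w (k + 1) n := by
    intro k
    filter_upwards [hw1, eventually_ge_atTop (k + 1 + d), hlamle k] with n h1 hn h2
    rw [log_probDegree (hw0 n) (by omega)]
    have h3 := lb_lower (hw0 n) h1 (n - (k + 1)) (k + 1)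
    rw [show n - (k + 1) + (k + 1) = n by omega] at h3
    push_cast at h3
    have := mul_le_mul_of_nonneg_left h2 (show (0 : ℝ) ≤ (k : ℝ) + 1 by positivity)
    linarith
  have hupt : ∀ k : ℕ, Tendsto (fun n : ℕ => ((Real.log ((n - 1).choose k : ℕ) +
      ((k + 1).choose 2 : ℕ) * Real.log (w n)) -
        ((k : ℝ) + 1) * lam d w (k + 1) n) / Real.log n) atTop
        (nhds (-(((k : ℝ) - d) / ((d : ℝ) + 1)) ^ 2)) := by
    intro k
    have h := (base_tendsto d w hw k).sub ((lam_tendsto d w hw (k + 1)).const_mul ((k : ℝ) + 1))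
    rw [exponent_eq] at h
    refine h.congr fun n => ?_
    ring
  have hzero : ∀ k, k ≠ d → Tendsto (fun n : ℕ => probDegree n k (w n)) atTop (nhds 0) := by
    intro k hk
    have hneg : -(((k : ℝ) - d) / ((d : ℝ) + 1)) ^ 2 < 0 := by
      have : (k : ℝ) - d ≠ 0 := sub_ne_zero.2 (by exact_mod_cast hk)
      have : ((k : ℝ) - d) / ((d : ℝ) + 1) ≠ 0 := div_ne_zero this hd1.ne'
      have := sq_pos_of_ne_zero this
      linarith
    have h1 := Real.tendsto_exp_atBot.comp ((hupt k).neg_mul_atTop hneg tendsto_log_nat)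
    refine tendsto_of_tendsto_of_tendsto_of_le_of_le' tendsto_const_nhds h1 ?_ ?_
    · filter_upwards [eventually_ge_atTop (k + 1)] with n hn
      exact (probDegree_pos (hw0 n) hn).le
    · filter_upwards [eventually_ge_atTop (k + 1), hup k, eventually_gt_atTop 1] with n hn h2 hn2
      have hn1 : (1 : ℝ) < n := by exact_mod_cast hn2
      have hl : 0 < Real.log n := Real.log_pos hn1
      simp only [Function.comp_apply]
      rw [div_mul_cancel₀ _ hl.ne', ← Real.log_le_iff_le_exp (probDegree_pos (hw0 n) hn)]
      exact h2
  have hmain : Tendsto (fun n : ℕ => probDegree n d (w n)) atTop (nhds 1) := by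
    set K := 4 * (d + 1) ^ 2 + 2 with hK
    have hdK : d < K := by rw [hK]; nlinarith
    have htail : Tendsto (fun n : ℕ => ∑ k ∈ Finset.Ico K n, probDegree n k (w n)) atTop
        (nhds 0) := by
      refine tendsto_of_tendsto_of_tendsto_of_le_of_le' tendsto_const_nhds
        (tendsto_one_div_atTop_nhds_zero_nat (𝕜 := ℝ)) ?_ ?_
      · filter_upwards with n
        refine Finset.sum_nonneg fun k hk => ?_
        rw [Finset.mem_Ico] at hk
        exact (probDegree_pos (hw0 n) (by omega)).le
      · filter_upwards [hsmall, hw1, eventually_gt_atTop 1] with n hs h1 hn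
        have hn1 : (1 : ℝ) < n := by exact_mod_cast hn
        have hn0 : (0 : ℝ) < n := by linarith
        have hterm : ∀ k ∈ Finset.Ico K n, probDegree n k (w n) ≤ (1 / (n : ℝ)) ^ 2 := by
          intro k hk
          rw [Finset.mem_Ico] at hk
          refine (probDegree_le (hw0 n) n k).trans ?_
          have hch : (d + 1) ^ 2 * (2 * k) ≤ (k + 1).choose 2 := by
            rw [Nat.choose_two_right, Nat.le_div_iff_mul_le (by norm_num), Nat.add_sub_cancel]
            have : 4 * (d + 1) ^ 2 ≤ k + 1 := by omega
            nlinarith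
          calc (n : ℝ) ^ k * (w n) ^ (k + 1).choose 2
              ≤ (n : ℝ) ^ k * (w n) ^ ((d + 1) ^ 2 * (2 * k)) := by
                refine mul_le_mul_of_nonneg_left ?_ (by positivity)
                exact pow_le_pow_of_le_one (hw0 n).le h1 hch
            _ = (n : ℝ) ^ k * ((w n) ^ ((d + 1) ^ 2)) ^ (2 * k) := by rw [pow_mul]
            _ ≤ (n : ℝ) ^ k * (1 / (n : ℝ)) ^ (2 * k) := by
                refine mul_le_mul_of_nonneg_left ?_ (by positivity)
                exact pow_le_pow_left₀ (pow_nonneg (hw0 n).le _) hs _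
            _ = (1 / (n : ℝ)) ^ k := by
                rw [two_mul, pow_add, ← mul_assoc, ← mul_pow, mul_one_div_cancel hn0.ne', one_pow,
                  one_mul]
            _ ≤ (1 / (n : ℝ)) ^ 2 := by
                refine pow_le_pow_of_le_one (by positivity) ?_ (by omega)
                rw [div_le_one hn0]; exact hn1.le
        have := Finset.sum_le_card_nsmul _ _ _ hterm
        refine this.trans ?_
        rw [Nat.card_Ico, nsmul_eq_mul]
        have hc : ((n - K : ℕ) : ℝ) ≤ n := by exact_mod_cast Nat.sub_le n K
        calc ((n - K : ℕ) : ℝ) * (1 / (n : ℝ)) ^ 2 ≤ n * (1 / (n : ℝ)) ^ 2 := by gcongr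
          _ = 1 / (n : ℝ) := by field_simp
    have hrest : Tendsto (fun n : ℕ => ∑ k ∈ (range K).erase d, probDegree n k (w n)) atTop
        (nhds 0) := by
      have := tendsto_finsetSum (f := fun k (n : ℕ) => probDegree n k (w n)) (a := fun _ => (0 : ℝ))
        ((range K).erase d) (fun k hk => hzero k (Finset.ne_of_mem_erase hk))
      simpa using this
    have h := (hrest.add htail).const_sub 1
    simp only [add_zero, sub_zero] at h
    refine h.congr' ?_
    filter_upwards [eventually_ge_atTop K] with n hn
    have hs := sum_probDegree (hw0 n) (show 1 ≤ n by omega)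
    rw [← Finset.sum_range_add_sum_Ico _ hn,
      ← Finset.add_sum_erase (range K) _ (Finset.mem_range.2 hdK)] at hs
    linarith
  refine ⟨hmain, fun k hk => ?_⟩
  -- lower bound
  have hlogd : Tendsto (fun n : ℕ => Real.log (probDegree n d (w n)) / Real.log n) atTop
      (nhds 0) := by
    have h1 : Tendsto (fun n : ℕ => Real.log (probDegree n d (w n))) atTop (nhds 0) := by
      have := (Real.continuousAt_log one_ne_zero).tendsto.comp hmain
      rwa [Real.log_one] at this
    exact h1.div_atTop tendsto_log_nat
  have hVt : Tendsto (fun n : ℕ => ((Real.log ((n - 1).choose k : ℕ) +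
      ((k + 1).choose 2 : ℕ) * Real.log (w n)) - ((k : ℝ) + 1) *
        ((Real.log ((n - 1).choose d : ℕ) + ((d + 1).choose 2 : ℕ) * Real.log (w n))
          - Real.log (probDegree n d (w n)) - (d : ℝ) * lam d w (d + 1) n)) / Real.log n) atTop
        (nhds (-(((k : ℝ) - d) / ((d : ℝ) + 1)) ^ 2)) := by
    have h := (base_tendsto d w hw k).sub ((((base_tendsto d w hw d).sub hlogd).sub
      ((lam_tendsto d w hw (d + 1)).const_mul (d : ℝ))).const_mul ((k : ℝ) + 1))
    have e : (d : ℝ) - ((d : ℝ) + 1) * d / ((d : ℝ) + 1) ^ 2 - 0 -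
        (d : ℝ) * ((d : ℝ) / ((d : ℝ) + 1)) ^ 2 = ((d : ℝ) / ((d : ℝ) + 1)) ^ 2 := by
      field_simp
      ring
    rw [e, exponent_eq] at h
    refine h.congr fun n => ?_
    ring
  refine tendsto_of_tendsto_of_tendsto_of_le_of_le' hVt (hupt k) ?_ ?_
  · filter_upwards [hw1, eventually_ge_atTop (k + 1 + d + 1), hlamle d, eventually_gt_atTop 1]
      with n h1 hn h2 hn2
    have hn1 : (1 : ℝ) < n := by exact_mod_cast hn2
    have hl : 0 < Real.log n := Real.log_pos hn1
    refine (div_le_div_iff_of_pos_right hl).2 ?_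
    rw [log_probDegree (hw0 n) (show k + 1 ≤ n by omega),
      log_probDegree (hw0 n) (show d + 1 ≤ n by omega)]
    have h3 := lb_lower (hw0 n) h1 (n - (d + 1)) d
    have h4 := lb_upper (hw0 n) h1 (n - (k + 1)) k
    rw [show n - (d + 1) + d = n - 1 by omega] at h3
    rw [show n - (k + 1) + k + 1 = n by omega, show n - (k + 1) + k = n - 1 by omega] at h4
    have h5 := mul_le_mul_of_nonneg_left h2 (Nat.cast_nonneg (α := ℝ) d)
    have h6 : lb (w n) n - lb (w n) (n - 1) ≤ lb (w n) n - lb (w n) (n - (d + 1)) -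
        (d : ℝ) * lam d w (d + 1) n := by linarith
    have h7 := mul_le_mul_of_nonneg_left h6 (show (0 : ℝ) ≤ (k : ℝ) + 1 by positivity)
    linarith
  · filter_upwards [hup k, eventually_gt_atTop 1] with n h hn2
    have hn1 : (1 : ℝ) < n := by exact_mod_cast hn2
    have hl : 0 < Real.log n := Real.log_pos hn1
    exact (div_le_div_iff_of_pos_right hl).2 h
end Core

/-- for `p_n = n^{-2/(d+1)² + o(1)}` the degree of a random vertex of
`CG_{n,p_n}` converges to `d` in probability, and `P(D = d') = n^{-((d'-d)/(d+1))² + o(1)}`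
for `d' ≠ d`. -/
theorem fixed_degree_sparse_regime (d : ℕ) (p : ℕ → ℝ)
    (hp01 : ∀ n, p n ∈ Set.Ioo (0 : ℝ) 1)
    (hp : Tendsto (fun n : ℕ => Real.log (p n) / Real.log n) atTop
      (nhds (-2 / ((d : ℝ) + 1) ^ 2))) :
    Tendsto (fun n : ℕ => probDegree n d (p n / (1 - p n))) atTop (nhds 1) ∧
    ∀ d' : ℕ, d' ≠ d →
      Tendsto (fun n : ℕ => Real.log (probDegree n d' (p n / (1 - p n))) / Real.log n) atTop
        (nhds (-(((d' : ℝ) - d) / ((d : ℝ) + 1)) ^ 2)) := by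
  have hc : (-2 / ((d : ℝ) + 1) ^ 2) < 0 := div_neg_of_neg_of_pos (by norm_num) (by positivity)
  have hp0 : Tendsto p atTop (nhds 0) := by
    have h1 := Real.tendsto_exp_atBot.comp (hp.neg_mul_atTop hc tendsto_log_nat)
    refine h1.congr' ?_
    filter_upwards [eventually_gt_atTop 1] with n hn2
    have hn1 : (1 : ℝ) < n := by exact_mod_cast hn2
    have hl : 0 < Real.log n := Real.log_pos hn1
    simp only [Function.comp_apply]
    rw [div_mul_cancel₀ _ hl.ne', Real.exp_log (hp01 n).1]
  refine core d (fun n => p n / (1 - p n)) (fun n => ?_) ?_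
  · exact div_pos (hp01 n).1 (by linarith [(hp01 n).2])
  · have h1 : Tendsto (fun n => Real.log (1 - p n)) atTop (nhds 0) := by
      have h2 : Tendsto (fun n => 1 - p n) atTop (nhds 1) := by
        simpa using hp0.const_sub 1
      have := (Real.continuousAt_log one_ne_zero).tendsto.comp h2
      rwa [Real.log_one] at this
    have h3 := hp.sub (h1.div_atTop tendsto_log_nat)
    rw [sub_zero] at h3
    refine h3.congr fun n => ?_
    rw [Real.log_div (hp01 n).1.ne' (by linarith [(hp01 n).2]), sub_div]
end
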